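/- Let F be a field with char F ≠ 2 and let n ≥ 1. For any integers α, β with 1 ≤ α ≤ n and 1 ≤ β ≤ n, the set of G-orbits on the triple flag variety M_{(α)} × M_{(β)} × M_{(n)} under the diagonal action of G = O_{2n+1}(F) is finite. -/

import Mathlib

open Module

/-- The symmetric bilinear form on `F^N` given by `(e_i, e_j) = δ_{i, N+1-j}`
(in 1-indexed notation), i.e. `(u, v) = ∑ i, u i * v (rev i)`. -/
def bform (F : Type*) [Field F] (N : ℕ) (u v : Fin N → F) : F :=
  ∑ i, u i * v i.rev

/-- `g` belongs to the split orthogonal group `O_N(F)`. -/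
def IsOrthMap (F : Type*) [Field F] (N : ℕ)
    (g : (Fin N → F) ≃ₗ[F] (Fin N → F)) : Prop :=
  ∀ u v, bform F N (g u) (g v) = bform F N u v

/-- A subspace `V` is isotropic if `(V, V) = {0}`. -/
def IsIsotropic (F : Type*) [Field F] (N : ℕ) (V : Submodule F (Fin N → F)) : Prop :=
  ∀ u ∈ V, ∀ v ∈ V, bform F N u v = 0

/-- A flag of type `a = (a 0, …, a (p-1))` in `F^{2n+1}` : an increasing chain of
subspaces `V 0 ⊆ ⋯ ⊆ V (p-1)` with `dim (V i) = a 0 + ⋯ + a i` which is isotropic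
(equivalently, by monotonicity, whose top member is isotropic). -/
def IsFlag (F : Type*) [Field F] (n p : ℕ) (a : Fin p → ℕ)
    (V : Fin p → Submodule F (Fin (2*n+1) → F)) : Prop :=
  Monotone V ∧ (∀ i : Fin p, finrank F (V i) = ∑ j ∈ Finset.Iic i, a j) ∧
    ∀ i : Fin p, IsIsotropic F (2*n+1) (V i)

/-- The flag variety `M_a`. -/
def FlagVar (F : Type*) [Field F] (n p : ℕ) (a : Fin p → ℕ) :=
  { V : Fin p → Submodule F (Fin (2*n+1) → F) // IsFlag F n p a V }

/-- The orbit relation of the diagonal action of `O_{2n+1}(F)` on the triple flag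
variety `M_a × M_b × M_c`. -/
def TripleRel (F : Type*) [Field F] (n p q r : ℕ)
    (a : Fin p → ℕ) (b : Fin q → ℕ) (c : Fin r → ℕ)
    (x y : FlagVar F n p a × FlagVar F n q b × FlagVar F n r c) : Prop :=
  ∃ g : (Fin (2*n+1) → F) ≃ₗ[F] (Fin (2*n+1) → F), IsOrthMap F (2*n+1) g ∧
    (∀ i, Submodule.map g.toLinearMap (x.1.1 i) = y.1.1 i) ∧
    (∀ i, Submodule.map g.toLinearMap (x.2.1.1 i) = y.2.1.1 i) ∧
    (∀ i, Submodule.map g.toLinearMap (x.2.2.1 i) = y.2.2.1 i)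

namespace OrthTriple

section triple


variable {F : Type*} [Field F] {V : Type*} [AddCommGroup V] [Module F V]

/-- The finite set of scalars allowed in normal forms. -/
def coeffs (c : F) : Set F := {0, 1, -1, c, -(c / 2)}

lemma zero_mem_coeffs (c : F) : (0 : F) ∈ coeffs c := by simp [coeffs]
lemma one_mem_coeffs (c : F) : (1 : F) ∈ coeffs c := by simp [coeffs]
lemma neg_one_mem_coeffs (c : F) : (-1 : F) ∈ coeffs c := by simp [coeffs]
lemma self_mem_coeffs (c : F) : c ∈ coeffs c := by simp [coeffs]
lemma neg_half_mem_coeffs (c : F) : -(c / 2) ∈ coeffs c := by simp [coeffs]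

/-- Three isotropic subspaces of a nondegenerate quadratic space, the first one of which, `W`, is
maximal: `φ` identifies `Wᗮ / W` with a subspace of the line with form `c x y`. -/
structure IsTriple (c : F) (B : LinearMap.BilinForm F V) (φ : V →ₗ[F] F)
    (W U₁ U₂ : Submodule F V) : Prop where
  two_ne : (2 : F) ≠ 0
  coeff_ne : c ≠ 0
  symm : ∀ x y, B x y = B y x
  nondeg : ∀ x, (∀ y, B x y = 0) → x = 0
  isoW : ∀ x ∈ W, ∀ y ∈ W, B x y = 0
  iso₁ : ∀ x ∈ U₁, ∀ y ∈ U₁, B x y = 0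
  iso₂ : ∀ x ∈ U₂, ∀ y ∈ U₂, B x y = 0
  perp : ∀ x y, (∀ w ∈ W, B x w = 0) → (∀ w ∈ W, B y w = 0) → B x y = c * (φ x * φ y)
  mem_of_perp : ∀ x, (∀ w ∈ W, B x w = 0) → φ x = 0 → x ∈ W

/-- `U` is the sum of its intersections with `span h` and with the orthogonal complement of
`h`, the former being spanned by combinations of `h` with coefficients in `S`. -/
def SplitsAlong (S : Set F) (B : LinearMap.BilinForm F V) {k : ℕ} (h : Fin k → V)
    (U : Submodule F V) : Prop :=
  ∃ (m : ℕ) (A : Fin m → Fin k → F), (∀ j i, A j i ∈ S) ∧ (∀ j, ∑ i, A j i • h i ∈ U) ∧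
    ∀ x ∈ U, ∃ t : Fin m → F, ∀ i, B x (h i) = ∑ j, t j * ∑ l, A j l * B (h l) (h i)

/-- The family `h` spans a nondegenerate subspace along which the whole triple splits. -/
structure IsBlock (S : Set F) (B : LinearMap.BilinForm F V) (W U₁ U₂ : Submodule F V)
    {k : ℕ} (h : Fin k → V) : Prop where
  gram : ∀ i j, B (h i) (h j) ∈ S
  nondeg : ∀ a : Fin k → F, (∀ j, ∑ i, a i * B (h i) (h j) = 0) → a = 0
  splitsW : SplitsAlong S B h W
  splits₁ : SplitsAlong S B h U₁
  splits₂ : SplitsAlong S B h U₂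

/-- No nonempty block splits off. -/
def IsIrred (S : Set F) (B : LinearMap.BilinForm F V) (W U₁ U₂ : Submodule F V) : Prop :=
  ∀ (k : ℕ) (h : Fin (k + 1) → V), ¬ IsBlock S B W U₁ U₂ h

/-- There is a basis with Gram matrix in `S` such that all three subspaces are spanned by vectors
with coordinates in `S`. -/
def HasNormalForm (S : Set F) (B : LinearMap.BilinForm F V) (W U₁ U₂ : Submodule F V) : Prop :=
  ∃ (ι : Type) (_ : Fintype ι) (b : Basis ι F V), (∀ i j, B (b i) (b j) ∈ S) ∧
    ∀ U ∈ [W, U₁, U₂], ∃ s : Set (ι → F), (∀ a ∈ s, ∀ i, a i ∈ S) ∧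
      U = Submodule.span F ((fun a => ∑ i, a i • b i) '' s)

variable {c : F} {B : LinearMap.BilinForm F V} {φ : V →ₗ[F] F} {W U₁ U₂ : Submodule F V}

lemma IsTriple.swap (h : IsTriple c B φ W U₁ U₂) : IsTriple c B φ W U₂ U₁ :=
  ⟨h.two_ne, h.coeff_ne, h.symm, h.nondeg, h.isoW, h.iso₂, h.iso₁, h.perp, h.mem_of_perp⟩

lemma IsIrred.swap {S : Set F} (h : IsIrred S B W U₁ U₂) : IsIrred S B W U₂ U₁ :=
  fun k v hv => h k v ⟨hv.gram, hv.nondeg, hv.splitsW, hv.splits₂, hv.splits₁⟩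

/-- Functionals on two subspaces which agree modulo `Wᗮ` are jointly represented by an
element of `W`. -/
lemma exists_mem_represent [FiniteDimensional F V] (hs : ∀ x y, B x y = B y x)
    (W U₁ U₂ : Submodule F V) (z₁ z₂ : V)
    (h : ∀ u ∈ U₁, ∀ v ∈ U₂, (∀ w ∈ W, B (u - v) w = 0) → B z₁ u = B z₂ v) :
    ∃ w ∈ W, (∀ u ∈ U₁, B w u = B z₁ u) ∧ ∀ v ∈ U₂, B w v = B z₂ v := by
  let L : (U₁ × U₂) →ₗ[F] Dual F W :=
    W.subtype.dualMap.comp (LinearMap.comp B (U₁.subtype.comp (LinearMap.fst F U₁ U₂))) -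
      W.subtype.dualMap.comp (LinearMap.comp B (U₂.subtype.comp (LinearMap.snd F U₁ U₂)))
  let g : Dual F (U₁ × U₂) :=
    (B z₁).comp (U₁.subtype.comp (LinearMap.fst F U₁ U₂)) -
      (B z₂).comp (U₂.subtype.comp (LinearMap.snd F U₁ U₂))
  have hg : g ∈ LinearMap.range L.dualMap := by
    rw [LinearMap.range_dualMap_eq_dualAnnihilator_ker, Submodule.mem_dualAnnihilator]
    rintro ⟨u, v⟩ huv
    have := h u u.2 v v.2 (fun w hw => by
      have := LinearMap.congr_fun (LinearMap.mem_ker.1 huv) ⟨w, hw⟩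
      simpa [L] using this)
    simp [g, this]
  obtain ⟨θ, hθ⟩ := hg
  obtain ⟨w, rfl⟩ := (Module.evalEquiv F W).surjective θ
  refine ⟨w, w.2, fun u hu => ?_, fun v hv => ?_⟩
  · have := LinearMap.congr_fun hθ (⟨u, hu⟩, 0)
    simpa [L, g, hs w.1 u] using this
  · have := LinearMap.congr_fun hθ (0, ⟨v, hv⟩)
    simpa [L, g, hs w.1 v] using this

/-- A vector outside `A` is detected by `Aᗮ`. -/
lemma IsTriple.exists_perp [FiniteDimensional F V] (hT : IsTriple c B φ W U₁ U₂)
    {A : Submodule F V} {x : V} (hx : x ∉ A) :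
    ∃ y, (∀ a ∈ A, B y a = 0) ∧ B y x = 1 := by
  obtain ⟨f, hf, hA⟩ := Submodule.exists_dual_map_eq_bot_of_notMem hx inferInstance
  have hinj : Function.Injective B := by
    rw [injective_iff_map_eq_zero]
    exact fun y hy => hT.nondeg y fun z => by simp [hy]
  obtain ⟨y, rfl⟩ := (LinearMap.injective_iff_surjective_of_finrank_eq_finrank
    (Subspace.dual_finrank_eq (K := F) (V := V)).symm).1 hinj f
  refine ⟨(B y x)⁻¹ • y, fun a ha => ?_, by simp [hf]⟩
  have : B y a ∈ A.map (B y) := ⟨a, ha, rfl⟩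
  rw [hA] at this
  simp [(Submodule.mem_bot F).1 this]

lemma splitsAlong_of_perp {S : Set F} {k : ℕ} {h : Fin k → V} {U : Submodule F V}
    (hU : ∀ x ∈ U, ∀ i, B x (h i) = 0) : SplitsAlong S B h U :=
  ⟨0, Fin.elim0, fun j => j.elim0, fun j => j.elim0, fun x hx => ⟨Fin.elim0, by simp [hU x hx]⟩⟩

/-- Splitting when the block part of `U` is spanned by part of the block itself. -/
lemma splitsAlong_of_mem {k m : ℕ} {h : Fin k → V} {U : Submodule F V}
    (e : Fin m → Fin k) (he : ∀ j, h (e j) ∈ U)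
    (hU : ∀ x ∈ U, ∃ t : Fin m → F, ∀ i, B x (h i) = ∑ j, t j * B (h (e j)) (h i)) :
    SplitsAlong (coeffs c) B h U := by
  refine ⟨m, fun j => Pi.single (e j) 1, fun j i => ?_, fun j => ?_, fun x hx => ?_⟩
  · by_cases hij : i = e j
    · subst hij; simp [coeffs]
    · simp [coeffs, hij]
  · simpa [Pi.single_apply, ite_smul] using he j
  · obtain ⟨t, ht⟩ := hU x hx
    exact ⟨t, fun i => by simp [ht, Pi.single_apply]⟩

/-- Splitting of `U` along a hyperbolic plane meeting it in the line of `w`. -/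
lemma splitsAlong_plane_left {w f : V} {U : Submodule F V} (hw : w ∈ U)
    (hU : ∀ x ∈ U, B x w = 0) (hwf : B w f = 1) : SplitsAlong (coeffs c) B ![w, f] U := by
  refine splitsAlong_of_mem ![0] (by simpa) fun x hx => ⟨![B x f], ?_⟩
  simp [Fin.forall_fin_succ, hU _ hx, hU _ hw, hwf]

lemma splitsAlong_plane_right {w f : V} {U : Submodule F V} (hf : f ∈ U)
    (hU : ∀ x ∈ U, B x f = 0) (hfw : B f w = 1) : SplitsAlong (coeffs c) B ![w, f] U := by
  refine splitsAlong_of_mem ![1] (by simpa) fun x hx => ⟨![B x w], ?_⟩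
  simp [Fin.forall_fin_succ, hU _ hx, hU _ hf, hfw]

lemma splitsAlong_plane_perp {w f : V} {U : Submodule F V}
    (hw : ∀ x ∈ U, B x w = 0) (hf : ∀ x ∈ U, B x f = 0) :
    SplitsAlong (coeffs c) B ![w, f] U :=
  splitsAlong_of_perp fun x hx => by simp [Fin.forall_fin_succ, hw x hx, hf x hx]

lemma isBlock_plane (hT : IsTriple c B φ W U₁ U₂) {w f : V} (hw : w ∈ W) (hwf : B w f = 1)
    (hff : B f f = 0) (h₁ : SplitsAlong (coeffs c) B ![w, f] U₁)
    (h₂ : SplitsAlong (coeffs c) B ![w, f] U₂) : IsBlock (coeffs c) B W U₁ U₂ ![w, f] := by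
  have hfw : B f w = 1 := (hT.symm _ _).trans hwf
  have hww := hT.isoW w hw w hw
  refine ⟨?_, fun a ha => ?_, splitsAlong_plane_left hw (fun x hx => hT.isoW x hx w hw) hwf, h₁, h₂⟩
  · simp [Fin.forall_fin_succ, hfw, hww, hwf, hff, zero_mem_coeffs, one_mem_coeffs]
  · simp [Fin.forall_fin_succ, Fin.sum_univ_succ, hfw, hww, hwf, hff] at ha
    ext i
    fin_cases i <;> simp [ha]

/-- In an irreducible triple, `U₁` meets `W` trivially. -/
lemma IsIrred.eq_zero_of_mem [FiniteDimensional F V]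
    (hT : IsTriple c B φ W U₁ U₂) (hN : IsIrred (coeffs c) B W U₁ U₂)
    {w : V} (hw₁ : w ∈ U₁) (hw : w ∈ W) : w = 0 := by
  have h2 := hT.two_ne
  by_contra h0
  have hww := hT.isoW w hw w hw
  have key : ∀ f, B f w = 1 → B f f = 0 → SplitsAlong (coeffs c) B ![w, f] U₂ → False :=
    fun f hf hff h₂ => hN 1 _ (isBlock_plane hT hw ((hT.symm _ _).trans hf) hff
      (splitsAlong_plane_left hw₁ (fun x hx => hT.iso₁ x hx w hw₁) ((hT.symm _ _).trans hf)) h₂)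
  by_cases hperp : ∀ f ∈ U₂, B f w = 0
  · by_cases hw₂ : w ∈ U₂
    · obtain ⟨f, -, hf⟩ := hT.exists_perp (A := ⊥) (x := w) (by simpa using h0)
      have hwf := (hT.symm w f).trans hf
      refine key (f - (B f f / 2) • w) (by simp [hf, hww]) ?_
        (splitsAlong_plane_left hw₂ hperp (by simp [hwf, hww]))
      simp [hf, hww, hwf]; field_simp; ring
    · obtain ⟨f, hfA, hf⟩ := hT.exists_perp (A := U₂) (x := w) hw₂
      have hwf := (hT.symm w f).trans hf
      refine key (f - (B f f / 2) • w) (by simp [hf, hww]) ?_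
        (splitsAlong_plane_perp hperp fun x hx => ?_)
      · simp [hf, hww, hwf]; field_simp; ring
      · simp [hperp x hx, hT.symm x f, hfA x hx]
  · push Not at hperp
    obtain ⟨f, hf₂, hf⟩ := hperp
    have hf' : (B f w)⁻¹ • f ∈ U₂ := U₂.smul_mem _ hf₂
    refine key ((B f w)⁻¹ • f) (by simp [hf]) (hT.iso₂ _ hf' _ hf')
      (splitsAlong_plane_right hf' (fun x hx => hT.iso₂ x hx _ hf') (by simp [hf]))

lemma IsIrred.eq_zero_of_perp [FiniteDimensional F V]
    (hT : IsTriple c B φ W U₁ U₂) (hN : IsIrred (coeffs c) B W U₁ U₂)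
    {u : V} (hu : u ∈ U₁) (hw : ∀ w ∈ W, B u w = 0) : u = 0 := by
  refine hN.eq_zero_of_mem hT hu (hT.mem_of_perp u hw ?_)
  simpa [hT.coeff_ne] using (hT.perp u u hw hw).symm.trans (hT.iso₁ u hu u hu)

lemma IsIrred.exists_mem_eq_one [FiniteDimensional F V]
    (hT : IsTriple c B φ W U₁ U₂) (hN : IsIrred (coeffs c) B W U₁ U₂)
    {u : V} (hu : u ∈ U₁) (h0 : u ≠ 0) : ∃ w ∈ W, B w u = 1 := by
  by_contra! h
  refine h0 (hN.eq_zero_of_perp hT hu fun w hw => ?_)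
  by_contra hne
  exact h ((B u w)⁻¹ • w) (W.smul_mem _ hw) (by simp [hT.symm w u, hne])

/-- In an irreducible triple, `U₁` and `U₂` are disjoint. -/
lemma IsIrred.eq_zero_of_mem_of_mem [FiniteDimensional F V]
    (hT : IsTriple c B φ W U₁ U₂) (hN : IsIrred (coeffs c) B W U₁ U₂)
    {f : V} (h₁ : f ∈ U₁) (h₂ : f ∈ U₂) : f = 0 := by
  by_contra h0
  obtain ⟨w, hw, hwf⟩ := hN.exists_mem_eq_one hT h₁ h0
  have hfw := (hT.symm f w).trans hwf
  exact hN 1 _ (isBlock_plane hT hw hwf (hT.iso₁ f h₁ f h₁)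
    (splitsAlong_plane_right h₁ (fun x hx => hT.iso₁ x hx f h₁) hfw)
    (splitsAlong_plane_right h₂ (fun x hx => hT.iso₂ x hx f h₂) hfw))

lemma IsIrred.mem_sup [FiniteDimensional F V]
    (hT : IsTriple c B φ W U₁ U₂) (hN : IsIrred (coeffs c) B W U₁ U₂)
    {w : V} (hw : w ∈ W) (h₁ : ∀ x ∈ U₁, B x w = 0) (h₂ : ∀ x ∈ U₂, B x w = 0) :
    w ∈ U₁ ⊔ U₂ := by
  have h2 := hT.two_ne
  by_contra hA
  obtain ⟨f, hfA, hf⟩ := hT.exists_perp hA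
  have hwf := (hT.symm w f).trans hf
  have hww := hT.isoW w hw w hw
  refine hN 1 ![w, f - (B f f / 2) • w] (isBlock_plane hT hw (by simp [hwf, hww]) ?_
    (splitsAlong_plane_perp h₁ fun x hx => ?_) (splitsAlong_plane_perp h₂ fun x hx => ?_))
  · simp [hf, hww, hwf]; field_simp; ring
  · simp [h₁ x hx, hT.symm x f, hfA x (Submodule.mem_sup_left hx)]
  · simp [h₂ x hx, hT.symm x f, hfA x (Submodule.mem_sup_right hx)]

lemma IsIrred.exists_sub_perp [FiniteDimensional F V]
    (hT : IsTriple c B φ W U₁ U₂) (hN : IsIrred (coeffs c) B W U₁ U₂)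
    {f : V} (hf₁ : f ∈ U₁) (hf₂ : ∀ x ∈ U₂, B f x = 0) :
    ∃ v ∈ U₂, ∀ w ∈ W, B (f - v) w = 0 := by
  obtain h | h := em (f ∈ U₂ ⊔ LinearMap.BilinForm.orthogonal B W)
  · obtain ⟨v, hv, x, hx, rfl⟩ := Submodule.mem_sup.1 h
    exact ⟨v, hv, fun w hw => by
      have : B w x = 0 := hx w hw
      simpa [hT.symm x w] using this⟩
  · obtain ⟨y, hyA, hy⟩ := hT.exists_perp h
    have hyW : y ∈ W := by
      by_contra hyW
      obtain ⟨z, hz, hzy⟩ := hT.exists_perp hyW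
      have : B y z = 0 := hyA z (Submodule.mem_sup_right fun w hw => by
        change B w z = 0
        rw [hT.symm, hz w hw])
      rw [hT.symm, this] at hzy
      exact zero_ne_one hzy
    have hfy := (hT.symm f y).trans hy
    exact (hN 1 _ (isBlock_plane hT hyW hy (hT.iso₁ f hf₁ f hf₁)
      (splitsAlong_plane_right hf₁ (fun x hx => hT.iso₁ x hx f hf₁) hfy)
      (splitsAlong_plane_perp (fun x hx => (hT.symm _ _).trans (hyA x (Submodule.mem_sup_left hx)))
        fun x hx => (hT.symm _ _).trans (hf₂ x hx)))).elim

/-- `u - v` is orthogonal to `W`. -/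
def PerpDiff (B : LinearMap.BilinForm F V) (W U₁ U₂ : Submodule F V) (u v : V) : Prop :=
  u ∈ U₁ ∧ v ∈ U₂ ∧ ∀ w ∈ W, B (u - v) w = 0

lemma PerpDiff.apply_eq {u v w : V} (h : PerpDiff B W U₁ U₂ u v) (hw : w ∈ W) :
    B u w = B v w := by
  simpa [sub_eq_zero] using h.2.2 w hw

lemma PerpDiff.add_eq {u v u' v' : V} (h : PerpDiff B W U₁ U₂ u v)
    (h' : PerpDiff B W U₁ U₂ u' v') (hT : IsTriple c B φ W U₁ U₂) :
    B u v' + B v u' = -(c * (φ (u - v) * φ (u' - v'))) := by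
  rw [← hT.perp _ _ h.2.2 h'.2.2]
  simp [hT.iso₁ _ h.1 _ h'.1, hT.iso₂ _ h.2.1 _ h'.2.1]
  ring

lemma PerpDiff.swap {u v : V} (h : PerpDiff B W U₁ U₂ u v) : PerpDiff B W U₂ U₁ v u :=
  ⟨h.2.1, h.1, fun w hw => by rw [← neg_sub, map_neg, LinearMap.neg_apply, h.2.2 w hw, neg_zero]⟩

lemma PerpDiff.smul {u v : V} (h : PerpDiff B W U₁ U₂ u v) (t : F) :
    PerpDiff B W U₁ U₂ (t • u) (t • v) :=
  ⟨U₁.smul_mem _ h.1, U₂.smul_mem _ h.2.1, fun w hw => by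
    rw [← smul_sub, map_smul, LinearMap.smul_apply, h.2.2 w hw, smul_zero]⟩

lemma PerpDiff.sub {u v u' v' : V} (h : PerpDiff B W U₁ U₂ u v) (h' : PerpDiff B W U₁ U₂ u' v') :
    PerpDiff B W U₁ U₂ (u - u') (v - v') :=
  ⟨U₁.sub_mem h.1 h'.1, U₂.sub_mem h.2.1 h'.2.1, fun w hw => by
    rw [sub_sub_sub_comm, map_sub, LinearMap.sub_apply, h.2.2 w hw, h'.2.2 w hw, sub_zero]⟩

lemma PerpDiff.mem {u v : V} (h : PerpDiff B W U₁ U₂ u v) (hT : IsTriple c B φ W U₁ U₂)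
    (hφ : φ (u - v) = 0) : u - v ∈ W :=
  hT.mem_of_perp _ h.2.2 hφ

lemma IsIrred.apply_eq_zero_of_phi [FiniteDimensional F V]
    (hT : IsTriple c B φ W U₁ U₂) (hN : IsIrred (coeffs c) B W U₁ U₂) {u v u' v' : V}
    (h : PerpDiff B W U₁ U₂ u v) (hφ : φ (u - v) = 0)
    (h' : PerpDiff B W U₁ U₂ u' v') (hφ' : φ (u' - v') = 0) : B u v' = 0 := by
  by_contra hne
  obtain ⟨u, v, h, hφ, h14⟩ : ∃ u v, PerpDiff B W U₁ U₂ u v ∧ φ (u - v) = 0 ∧ B u v' = 1 :=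
    ⟨_, _, h.smul (B u v')⁻¹, by rw [← smul_sub, map_smul, hφ, smul_zero], by simp [hne]⟩
  have hw := h.mem hT hφ
  have hw' := h'.mem hT hφ'
  have h23 : B v u' = -1 := by
    have := h.add_eq h' hT
    rw [hφ, h14] at this
    linear_combination this
  have h12 : B u v = 0 := by
    have := h.add_eq h hT
    rw [hφ, hT.symm v u] at this
    have h2 := hT.two_ne
    grind
  have h34 : B u' v' = 0 := by
    have := h'.add_eq h' hT
    rw [hφ', hT.symm v' u'] at this
    have h2 := hT.two_ne
    grind
  have h41 := (hT.symm v' u).trans h14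
  have h32 := (hT.symm u' v).trans h23
  have h21 := (hT.symm v u).trans h12
  have h43 := (hT.symm v' u').trans h34
  have h11 := hT.iso₁ u h.1 u h.1
  have h13 := hT.iso₁ u h.1 u' h'.1
  have h31 := hT.iso₁ u' h'.1 u h.1
  have h33 := hT.iso₁ u' h'.1 u' h'.1
  have h22 := hT.iso₂ v h.2.1 v h.2.1
  have h24 := hT.iso₂ v h.2.1 v' h'.2.1
  have h42 := hT.iso₂ v' h'.2.1 v h.2.1
  have h44 := hT.iso₂ v' h'.2.1 v' h'.2.1
  refine hN 3 ![u, v, u', v'] ⟨?_, fun a ha => ?_,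
    ⟨2, ![![1, -1, 0, 0], ![0, 0, 1, -1]], ?_, ?_, fun x hx => ⟨![B x u', - B x u], ?_⟩⟩,
    splitsAlong_of_mem ![0, 2] ?_ fun x hx => ⟨![B x v', - B x v], ?_⟩,
    splitsAlong_of_mem ![1, 3] ?_ fun x hx => ⟨![-B x u', B x u], ?_⟩⟩
  · simp [Fin.forall_fin_succ, zero_mem_coeffs, one_mem_coeffs, neg_one_mem_coeffs, *]
  · simp [Fin.forall_fin_succ, Fin.sum_univ_succ, *] at ha
    ext i; fin_cases i <;> simp <;> grind
  · simp [Fin.forall_fin_succ, zero_mem_coeffs, one_mem_coeffs, neg_one_mem_coeffs]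
  · simpa [Fin.forall_fin_succ, Fin.sum_univ_succ, ← sub_eq_add_neg] using ⟨hw, hw'⟩
  · have e := h.apply_eq hx
    have e' := h'.apply_eq hx
    rw [hT.symm _ x, hT.symm _ x] at e e'
    simp [Fin.forall_fin_succ, Fin.sum_univ_succ, *]
  · simpa [Fin.forall_fin_succ] using ⟨h.1, h'.1⟩
  · simp [Fin.forall_fin_succ, Fin.sum_univ_succ, hT.iso₁ x hx _ h.1, hT.iso₁ x hx _ h'.1, *]
  · simpa [Fin.forall_fin_succ] using ⟨h.2.1, h'.2.1⟩
  · simp [Fin.forall_fin_succ, Fin.sum_univ_succ, hT.iso₂ x hx _ h.2.1, hT.iso₂ x hx _ h'.2.1, *]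

/-- Normalized pairing of a `PerpDiff` pair on which `φ` does not vanish. -/
lemma PerpDiff.apply_self {u v : V} (h : PerpDiff B W U₁ U₂ u v) (hT : IsTriple c B φ W U₁ U₂) :
    B u v = -(c / 2) * φ (u - v) ^ 2 := by
  have := h.add_eq h hT
  have h2 := hT.two_ne
  rw [hT.symm v u] at this
  field_simp
  linear_combination this

lemma IsIrred.apply_eq_zero [FiniteDimensional F V]
    (hT : IsTriple c B φ W U₁ U₂) (hN : IsIrred (coeffs c) B W U₁ U₂) {u v u' v' : V}
    (h : PerpDiff B W U₁ U₂ u v) (hφ : φ (u - v) = 0)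
    (h' : PerpDiff B W U₁ U₂ u' v') : B u v' = 0 := by
  by_contra hne
  have hφ' : φ (u' - v') ≠ 0 := fun hφ' => hne (hN.apply_eq_zero_of_phi hT h hφ h' hφ')
  obtain ⟨u', v', h', hφ', hne⟩ :
      ∃ u' v', PerpDiff B W U₁ U₂ u' v' ∧ φ (u' - v') = 1 ∧ B u v' ≠ 0 :=
    ⟨_, _, h'.smul (φ (u' - v'))⁻¹, by
      rw [← smul_sub, map_smul, smul_eq_mul, inv_mul_cancel₀ hφ'], by
      rw [map_smul, smul_eq_mul]; exact mul_ne_zero (inv_ne_zero hφ') hne⟩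
  obtain ⟨u, v, h, hφ, h14⟩ : ∃ u v, PerpDiff B W U₁ U₂ u v ∧ φ (u - v) = 0 ∧ B u v' = -1 :=
    ⟨_, _, h.smul (-(B u v')⁻¹), by rw [← smul_sub, map_smul, hφ, smul_zero], by simp [hne]⟩
  have h2 := hT.two_ne
  have hc := hT.coeff_ne
  have hw := h.mem hT hφ
  have h23 : B v u' = 1 := by
    have := h.add_eq h' hT
    rw [hφ, h14] at this
    linear_combination this
  have h12 : B u v = 0 := by simp [h.apply_self hT, hφ]
  have h34 : B u' v' = -(c / 2) := by simp [h'.apply_self hT, hφ']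
  have h41 := (hT.symm v' u).trans h14
  have h32 := (hT.symm u' v).trans h23
  have h21 := (hT.symm v u).trans h12
  have h43 := (hT.symm v' u').trans h34
  have h11 := hT.iso₁ u h.1 u h.1
  have h13 := hT.iso₁ u h.1 u' h'.1
  have h31 := hT.iso₁ u' h'.1 u h.1
  have h33 := hT.iso₁ u' h'.1 u' h'.1
  have h22 := hT.iso₂ v h.2.1 v h.2.1
  have h24 := hT.iso₂ v h.2.1 v' h'.2.1
  have h42 := hT.iso₂ v' h'.2.1 v h.2.1
  have h44 := hT.iso₂ v' h'.2.1 v' h'.2.1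
  obtain ⟨w, hwW, hw₁, hw₂⟩ := exists_mem_represent hT.symm W U₁ U₂ (-(c / 2) • v - v')
    (-(c / 2) • u + u') (by
      intro y hy y' hy' hyW
      have hy : PerpDiff B W U₁ U₂ y y' := ⟨hy, hy', hyW⟩
      have e := h.add_eq hy hT
      have e' := h'.add_eq hy hT
      obtain ⟨y₀, y₀', h₀, hφ₀, h₀y, h₀y'⟩ : ∃ y₀ y₀', PerpDiff B W U₁ U₂ y₀ y₀' ∧
          φ (y₀ - y₀') = 0 ∧ y = y₀ + φ (y - y') • u' ∧ y' = y₀' + φ (y - y') • v' :=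
        ⟨_, _, hy.sub (h'.smul (φ (y - y'))), by
          rw [sub_sub_sub_comm, ← smul_sub, map_sub, map_smul, hφ', smul_eq_mul, mul_one, sub_self],
          by simp, by simp⟩
      have f₁ := hN.apply_eq_zero_of_phi hT h hφ h₀ hφ₀
      have f₂ := hN.apply_eq_zero_of_phi hT h₀ hφ₀ h hφ
      rw [hT.symm] at f₂
      have f₃ := h'.add_eq h₀ hT
      rw [hφ₀, mul_zero, mul_zero, neg_zero] at f₃
      generalize φ (y - y') = t at h₀y h₀y'
      subst h₀y h₀y'
      simp [*]
      linear_combination -f₃)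
  have h51 := hw₁ u h.1
  have h52 := hw₂ v h.2.1
  have h53 := hw₁ u' h'.1
  have h54 := hw₂ v' h'.2.1
  simp [h21, h41, h12, h32, h23, h43, h14, h34] at h51 h52 h53 h54
  have h15 := (hT.symm u w).trans h51
  have h25 := (hT.symm v w).trans h52
  have h35 := (hT.symm u' w).trans h53
  have h45 := (hT.symm v' w).trans h54
  have h55 := hT.isoW w hwW w hwW
  refine hN 4 ![u, v, u', v', w] ⟨?_, fun a ha => ?_,
    ⟨2, ![![1, -1, 0, 0, 0], ![0, 0, 0, 0, 1]], ?_, ?_, fun x hx => ⟨![-B x u', B x u], ?_⟩⟩,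
    splitsAlong_of_mem ![0, 2] ?_ fun x hx => ⟨![-(c / 2) * B x v - B x v', B x v], ?_⟩,
    splitsAlong_of_mem ![1, 3] ?_ fun x hx => ⟨![-(c / 2) * B x u + B x u', -B x u], ?_⟩⟩
  · simp [Fin.forall_fin_succ, zero_mem_coeffs, one_mem_coeffs, neg_one_mem_coeffs,
      neg_half_mem_coeffs, *]
  · simp [Fin.forall_fin_succ, Fin.sum_univ_succ, *] at ha
    ext i; fin_cases i <;> simp <;> grind
  · simp [Fin.forall_fin_succ, zero_mem_coeffs, one_mem_coeffs, neg_one_mem_coeffs]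
  · simpa [Fin.forall_fin_succ, Fin.sum_univ_succ, ← sub_eq_add_neg] using ⟨hw, hwW⟩
  · have e := h.apply_eq hx
    have e' := h'.apply_eq hx
    rw [hT.symm _ x, hT.symm _ x] at e e'
    simp [Fin.forall_fin_succ, Fin.sum_univ_succ, hT.isoW x hx w hwW, *]
  · simpa [Fin.forall_fin_succ] using ⟨h.1, h'.1⟩
  · have e := hw₁ x hx
    rw [hT.symm, hT.symm _ x] at e
    simp [Fin.forall_fin_succ, Fin.sum_univ_succ, hT.iso₁ x hx _ h.1, hT.iso₁ x hx _ h'.1, *]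
    ring
  · simpa [Fin.forall_fin_succ] using ⟨h.2.1, h'.2.1⟩
  · have e := hw₂ x hx
    rw [hT.symm, hT.symm _ x] at e
    simp [Fin.forall_fin_succ, Fin.sum_univ_succ, hT.iso₂ x hx _ h.2.1, hT.iso₂ x hx _ h'.2.1, *]
    ring

lemma IsIrred.phi_eq_zero [FiniteDimensional F V]
    (hT : IsTriple c B φ W U₁ U₂) (hN : IsIrred (coeffs c) B W U₁ U₂) {u v : V}
    (h : PerpDiff B W U₁ U₂ u v) : φ (u - v) = 0 := by
  by_contra hφ
  obtain ⟨u, v, h, hφ⟩ : ∃ u v, PerpDiff B W U₁ U₂ u v ∧ φ (u - v) = 1 :=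
    ⟨_, _, h.smul (φ (u - v))⁻¹, by rw [← smul_sub, map_smul, smul_eq_mul, inv_mul_cancel₀ hφ]⟩
  have h2 := hT.two_ne
  have hc := hT.coeff_ne
  have h12 : B u v = -(c / 2) := by simp [h.apply_self hT, hφ]
  have h21 := (hT.symm v u).trans h12
  have h11 := hT.iso₁ u h.1 u h.1
  have h22 := hT.iso₂ v h.2.1 v h.2.1
  obtain ⟨w, hwW, hw₁, hw₂⟩ := exists_mem_represent hT.symm W U₁ U₂ (-(2 / c) • v) (-(2 / c) • u) (by
      intro y hy y' hy' hyW
      have hy : PerpDiff B W U₁ U₂ y y' := ⟨hy, hy', hyW⟩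
      obtain ⟨y₀, y₀', h₀, hφ₀, h₀y, h₀y'⟩ : ∃ y₀ y₀', PerpDiff B W U₁ U₂ y₀ y₀' ∧
          φ (y₀ - y₀') = 0 ∧ y = y₀ + φ (y - y') • u ∧ y' = y₀' + φ (y - y') • v :=
        ⟨_, _, hy.sub (h.smul (φ (y - y'))), by
          rw [sub_sub_sub_comm, ← smul_sub, map_sub, map_smul, hφ, smul_eq_mul, mul_one, sub_self],
          by simp, by simp⟩
      have f₁ := hN.apply_eq_zero hT h₀ hφ₀ h
      have f₂ := h.add_eq h₀ hT
      rw [hT.symm] at f₁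
      rw [hφ₀, f₁, mul_zero, mul_zero, neg_zero, add_zero] at f₂
      generalize φ (y - y') = t at h₀y h₀y'
      subst h₀y h₀y'
      simp [*])
  have h31 := hw₁ u h.1
  have h32 := hw₂ v h.2.1
  simp [h21, h12] at h31 h32
  field_simp at h31 h32
  have h13 := (hT.symm u w).trans h31
  have h23 := (hT.symm v w).trans h32
  have h33 := hT.isoW w hwW w hwW
  refine hN 2 ![u, v, w] ⟨?_, fun a ha => ?_,
    splitsAlong_of_mem ![2] ?_ fun x hx => ⟨![B x u], ?_⟩,
    splitsAlong_of_mem ![0] ?_ fun x hx => ⟨![-(2 / c) * B x v], ?_⟩,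
    splitsAlong_of_mem ![1] ?_ fun x hx => ⟨![-(2 / c) * B x u], ?_⟩⟩
  · simp [Fin.forall_fin_succ, zero_mem_coeffs, one_mem_coeffs, neg_half_mem_coeffs, *]
  · simp [Fin.forall_fin_succ, Fin.sum_univ_succ, *] at ha
    ext i; fin_cases i <;> simp <;> grind
  · simpa [Fin.forall_fin_succ]
  · have e := h.apply_eq hx
    rw [hT.symm _ x, hT.symm _ x] at e
    simp [Fin.forall_fin_succ, hT.isoW x hx w hwW, *]
  · simpa [Fin.forall_fin_succ] using h.1
  · have e := hw₁ x hx
    rw [hT.symm, hT.symm _ x] at e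
    simp [Fin.forall_fin_succ, hT.iso₁ x hx _ h.1, *]
    field_simp
  · simpa [Fin.forall_fin_succ] using h.2.1
  · have e := hw₂ x hx
    rw [hT.symm, hT.symm _ x] at e
    simp [Fin.forall_fin_succ, hT.iso₂ x hx _ h.2.1, *]
    field_simp

lemma IsIrred.perp_of_perpDiff [FiniteDimensional F V]
    (hT : IsTriple c B φ W U₁ U₂) (hN : IsIrred (coeffs c) B W U₁ U₂) {u v u' v' : V}
    (h : PerpDiff B W U₁ U₂ u v) (h' : PerpDiff B W U₁ U₂ u' v') : B u v' = 0 :=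
  hN.apply_eq_zero hT h (hN.phi_eq_zero hT h) h'


/-- A difference `u - v ∈ W` orthogonal to both `U₁` and `U₂` vanishes. -/
lemma IsIrred.eq_zero_of_perp_both [FiniteDimensional F V]
    (hT : IsTriple c B φ W U₁ U₂) (hN : IsIrred (coeffs c) B W U₁ U₂) {u v : V}
    (h : PerpDiff B W U₁ U₂ u v) (hu : ∀ y ∈ U₂, B u y = 0) (hv : ∀ y ∈ U₁, B v y = 0) :
    u = 0 := by
  by_contra h0
  have h2 := hT.two_ne
  have hφ := hN.phi_eq_zero hT h
  have hx := h.mem hT hφ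
  obtain ⟨w, hw, hwu⟩ := hN.exists_mem_eq_one hT h.1 h0
  obtain ⟨f, -, hf₁, hf₂⟩ := exists_mem_represent hT.symm ⊤ U₁ U₂ w 0 (by
    intro y hy y' hy' hyy
    have : y - y' = 0 := hT.nondeg _ fun z => hyy z trivial
    obtain rfl := sub_eq_zero.1 this
    simp [hN.eq_zero_of_mem_of_mem hT hy hy'])
  have h11 := hT.iso₁ u h.1 u h.1
  have h22 := hT.iso₂ v h.2.1 v h.2.1
  have h12 := hu v h.2.1
  have h21 := hv u h.1
  have hwv : B w v = 1 := by rw [hT.symm, ← h.apply_eq hw, hT.symm, hwu]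
  have hfu := hf₁ u h.1
  have hfv := hf₂ v h.2.1
  rw [hwu] at hfu
  rw [map_zero, LinearMap.zero_apply] at hfv
  have huf := (hT.symm u f).trans hfu
  have hvf := (hT.symm v f).trans hfv
  have huw := (hT.symm u w).trans hwu
  have hvw := (hT.symm v w).trans hwv
  have hww := hT.isoW w hw w hw
  obtain ⟨f, hff, hf₁, hf₂, hfu, hfv, huf, hvf⟩ : ∃ f, B f f = 0 ∧ (∀ y ∈ U₁, B f y = B w y) ∧
      (∀ y ∈ U₂, B f y = 0) ∧ B f u = 1 ∧ B f v = 0 ∧ B u f = 1 ∧ B v f = 0 :=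
    ⟨f - (B f f / 2) • u, by simp [*]; field_simp; ring,
      fun y hy => by simp [hf₁ y hy, hT.iso₁ u h.1 y hy],
      fun y hy => by simp [hf₂ y hy, hu y hy], by simp [*], by simp [*], by simp [*], by simp [*]⟩
  obtain ⟨w, hw, hwf, hfw, hf₁, hwu, hwv, huw, hvw, hww⟩ : ∃ w ∈ W, B w f = 0 ∧ B f w = 0 ∧
      (∀ y ∈ U₁, B f y = B w y) ∧ B w u = 1 ∧ B w v = 1 ∧ B u w = 1 ∧ B v w = 1 ∧ B w w = 0 := by
    have e := hT.symm w f
    refine ⟨w - B f w • (u - v), W.sub_mem hw (W.smul_mem _ hx), by simp [*], by simp [*],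
      fun y hy => by simp [hf₁ y hy, hT.iso₁ u h.1 y hy, hv y hy], by simp [*], by simp [*],
      by simp [*], by simp [*], by simp [*]⟩
  refine hN 3 ![u, v, f, w] ⟨?_, fun a ha => ?_,
    ⟨2, ![![1, -1, 0, 0], ![0, 0, 0, 1]], ?_, ?_, fun x hx => ⟨![B x f, B x u], ?_⟩⟩,
    splitsAlong_of_mem ![0] ?_ fun x hx => ⟨![B x w], ?_⟩,
    splitsAlong_of_mem ![1] ?_ fun x hx => ⟨![B x w], ?_⟩⟩
  · simp [Fin.forall_fin_succ, zero_mem_coeffs, one_mem_coeffs, *]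
  · simp [Fin.forall_fin_succ, Fin.sum_univ_succ, *] at ha
    ext i; fin_cases i <;> simp <;> grind
  · simp [Fin.forall_fin_succ, zero_mem_coeffs, one_mem_coeffs, neg_one_mem_coeffs]
  · simpa [Fin.forall_fin_succ, Fin.sum_univ_succ, ← sub_eq_add_neg] using ⟨by assumption, hw⟩
  · have e := h.apply_eq hx
    rw [hT.symm _ x, hT.symm _ x] at e
    simp [Fin.forall_fin_succ, Fin.sum_univ_succ, hT.isoW x hx w hw, *]
  · simpa [Fin.forall_fin_succ] using h.1
  · have e := hf₁ x hx
    rw [hT.symm, hT.symm _ x] at e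
    simp [Fin.forall_fin_succ, hT.iso₁ x hx _ h.1, (hT.symm x v).trans (hv x hx), *]
  · simpa [Fin.forall_fin_succ] using h.2.1
  · have e := hf₂ x hx
    rw [hT.symm] at e
    simp [Fin.forall_fin_succ, hT.iso₂ x hx _ h.2.1, (hT.symm x u).trans (hu x hx), *]

lemma IsIrred.eq_zero_of_perp_right [FiniteDimensional F V]
    (hT : IsTriple c B φ W U₁ U₂) (hN : IsIrred (coeffs c) B W U₁ U₂) {u v : V}
    (h : PerpDiff B W U₁ U₂ u v) (hu : ∀ y ∈ U₂, B u y = 0) : u = 0 := by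
  by_cases hv : ∀ y ∈ U₁, B v y = 0
  · exact hN.eq_zero_of_perp_both hT h hu hv
  exfalso
  push Not at hv
  obtain ⟨u', hu', hvu⟩ := hv
  obtain ⟨u', hu', h23⟩ : ∃ u' ∈ U₁, B v u' = 1 :=
    ⟨(B v u')⁻¹ • u', U₁.smul_mem _ hu', by simp [hvu]⟩
  have hx := h.mem hT (hN.phi_eq_zero hT h)
  have h32 := (hT.symm u' v).trans h23
  have h11 := hT.iso₁ u h.1 u h.1
  have h22 := hT.iso₂ v h.2.1 v h.2.1
  have h13 := hT.iso₁ u h.1 u' hu'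
  have h31 := hT.iso₁ u' hu' u h.1
  have h33 := hT.iso₁ u' hu' u' hu'
  have h12 := hu v h.2.1
  have h21 := (hT.symm v u).trans h12
  obtain ⟨w, hw, -, hw₂⟩ := exists_mem_represent hT.symm W ⊥ U₂ 0 u' (by
    intro y hy y' hy' hyy
    obtain rfl := (Submodule.mem_bot F).1 hy
    have : y' = 0 := hN.swap.eq_zero_of_perp hT.swap hy' fun w hw => by simpa using hyy w hw
    simp [this])
  obtain ⟨w, hw, hw₂, h43⟩ : ∃ w ∈ W, (∀ y ∈ U₂, B w y = B u' y) ∧ B w u' = 0 :=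
    ⟨w + B w u' • (u - v), W.add_mem hw (W.smul_mem _ hx), fun y hy => by
      simp [hw₂ y hy, hu y hy, hT.iso₂ v h.2.1 y hy], by simp [h13, h23]⟩
  have h42 := (hw₂ v h.2.1).trans h32
  have h24 := (hT.symm v w).trans h42
  have h14 := (h.apply_eq hw).trans h24
  have h41 := (hT.symm w u).trans h14
  have h34 := (hT.symm u' w).trans h43
  have h44 := hT.isoW w hw w hw
  refine hN 3 ![u, v, u', w] ⟨?_, fun a ha => ?_,
    ⟨2, ![![1, -1, 0, 0], ![0, 0, 0, 1]], ?_, ?_, fun x hx => ⟨![-B x u', B x u], ?_⟩⟩,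
    splitsAlong_of_mem ![0, 2] ?_ fun x hx => ⟨![B x w, B x v], ?_⟩,
    splitsAlong_of_mem ![1] ?_ fun x hx => ⟨![B x u'], ?_⟩⟩
  · simp [Fin.forall_fin_succ, zero_mem_coeffs, one_mem_coeffs, *]
  · simp [Fin.forall_fin_succ, Fin.sum_univ_succ, *] at ha
    ext i; fin_cases i <;> simp <;> grind
  · simp [Fin.forall_fin_succ, zero_mem_coeffs, one_mem_coeffs, neg_one_mem_coeffs]
  · simpa [Fin.forall_fin_succ, Fin.sum_univ_succ, ← sub_eq_add_neg] using ⟨by assumption, hw⟩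
  · have e := h.apply_eq hx
    rw [hT.symm _ x, hT.symm _ x] at e
    simp [Fin.forall_fin_succ, Fin.sum_univ_succ, hT.isoW x hx w hw, *]
  · simpa [Fin.forall_fin_succ] using ⟨h.1, hu'⟩
  · simp [Fin.forall_fin_succ, Fin.sum_univ_succ, hT.iso₁ x hx _ h.1, hT.iso₁ x hx _ hu', *]
  · simpa [Fin.forall_fin_succ] using h.2.1
  · have e := hw₂ x hx
    rw [hT.symm, hT.symm _ x] at e
    simp [Fin.forall_fin_succ, hT.iso₂ x hx _ h.2.1, (hT.symm x u).trans (hu x hx), *]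

lemma IsIrred.eq_zero_of_perpDiff [FiniteDimensional F V]
    (hT : IsTriple c B φ W U₁ U₂) (hN : IsIrred (coeffs c) B W U₁ U₂) {u v : V}
    (h : PerpDiff B W U₁ U₂ u v) : u = 0 := by
  by_contra h0
  have hx := h.mem hT (hN.phi_eq_zero hT h)
  obtain ⟨z, hz, hzu⟩ := hN.exists_mem_eq_one hT h.1 h0
  have huz := (hT.symm u z).trans hzu
  have hvz := (h.apply_eq hz).symm.trans huz
  let E₁ : Submodule F V :=
    { carrier := {y | ∃ y', PerpDiff B W U₁ U₂ y y'}
      zero_mem' := ⟨0, U₁.zero_mem, U₂.zero_mem, by simp⟩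
      add_mem' := by
        rintro a b ⟨a', ha⟩ ⟨b', hb⟩
        refine ⟨a' + b', ?_⟩
        simpa using ha.sub (hb.smul (-1))
      smul_mem' := by
        rintro t a ⟨a', ha⟩
        exact ⟨t • a', ha.smul t⟩ }
  let E₂ : Submodule F V :=
    { carrier := {y' | ∃ y, PerpDiff B W U₁ U₂ y y'}
      zero_mem' := ⟨0, U₁.zero_mem, U₂.zero_mem, by simp⟩
      add_mem' := by
        rintro a b ⟨a', ha⟩ ⟨b', hb⟩
        refine ⟨a' + b', ?_⟩
        simpa using ha.sub (hb.smul (-1))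
      smul_mem' := by
        rintro t a ⟨a', ha⟩
        exact ⟨t • a', ha.smul t⟩ }
  obtain ⟨v', hv', hv'z, -⟩ := exists_mem_represent hT.symm U₂ E₁ ⊥ z 0 (by
    rintro y ⟨y', hy⟩ o ho hyy
    obtain rfl := (Submodule.mem_bot F).1 ho
    simp [hN.eq_zero_of_perp_right hT hy (by simpa using hyy)])
  obtain ⟨u', hu', hu'z, -⟩ := exists_mem_represent hT.symm U₁ E₂ ⊥ z 0 (by
    rintro y ⟨y', hy⟩ o ho hyy
    obtain rfl := (Submodule.mem_bot F).1 ho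
    simp [hN.swap.eq_zero_of_perp_right hT.swap hy.swap (by simpa using hyy)])
  have h11 := hT.iso₁ u h.1 u h.1
  have h22 := hT.iso₂ v h.2.1 v h.2.1
  have h12 := hN.perp_of_perpDiff hT h h
  have h21 := (hT.symm v u).trans h12
  have h41 := (hv'z u ⟨v, h⟩).trans hzu
  have h14 := (hT.symm u v').trans h41
  obtain ⟨u', hu', hu'z, h34⟩ : ∃ u' ∈ U₁, (∀ y ∈ E₂, B u' y = B z y) ∧ B u' v' = 0 :=
    ⟨u' - B u' v' • u, U₁.sub_mem hu' (U₁.smul_mem _ h.1), by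
      rintro y ⟨y', hy⟩
      simp [hu'z y ⟨y', hy⟩, hN.perp_of_perpDiff hT h hy], by simp [h14]⟩
  have h32 := (hu'z v ⟨u, h⟩).trans ((hT.symm z v).trans hvz)
  have h23 := (hT.symm v u').trans h32
  have h43 := (hT.symm v' u').trans h34
  have h13 := hT.iso₁ u h.1 u' hu'
  have h31 := hT.iso₁ u' hu' u h.1
  have h33 := hT.iso₁ u' hu' u' hu'
  have h24 := hT.iso₂ v h.2.1 v' hv'
  have h42 := hT.iso₂ v' hv' v h.2.1
  have h44 := hT.iso₂ v' hv' v' hv'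
  obtain ⟨w, hw, hw₁, hw₂⟩ := exists_mem_represent hT.symm W U₁ U₂ v' u' (by
    intro y hy y' hy' hyy
    have hyy : PerpDiff B W U₁ U₂ y y' := ⟨hy, hy', hyy⟩
    rw [hv'z y ⟨y', hyy⟩, hu'z y' ⟨y, hyy⟩, hT.symm, hT.symm z, hyy.apply_eq hz])
  obtain ⟨p, hp, hp₁, hp₂⟩ := exists_mem_represent hT.symm W U₁ U₂ v 0 (by
    intro y hy y' hy' hyy
    have hyy : PerpDiff B W U₁ U₂ y y' := ⟨hy, hy', hyy⟩
    rw [hT.symm, hN.perp_of_perpDiff hT hyy h, map_zero, LinearMap.zero_apply])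
  have h51 := (hw₁ u h.1).trans h41
  have h52 := (hw₂ v h.2.1).trans h32
  have h53 := (hw₁ u' hu').trans h43
  have h54 := (hw₂ v' hv').trans h34
  have h61 := (hp₁ u h.1).trans h21
  have h62 := hp₂ v h.2.1
  have h63 := (hp₁ u' hu').trans h23
  have h64 := hp₂ v' hv'
  rw [map_zero, LinearMap.zero_apply] at h62 h64
  have h15 := (hT.symm u w).trans h51
  have h25 := (hT.symm v w).trans h52
  have h35 := (hT.symm u' w).trans h53
  have h45 := (hT.symm v' w).trans h54
  have h16 := (hT.symm u p).trans h61
  have h26 := (hT.symm v p).trans h62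
  have h36 := (hT.symm u' p).trans h63
  have h46 := (hT.symm v' p).trans h64
  have h55 := hT.isoW w hw w hw
  have h56 := hT.isoW w hw p hp
  have h65 := hT.isoW p hp w hw
  have h66 := hT.isoW p hp p hp
  refine hN 5 ![u, v, u', v', w, p] ⟨?_, fun a ha => ?_,
    ⟨3, ![![1, -1, 0, 0, 0, 0], ![0, 0, 0, 0, 1, 0], ![0, 0, 0, 0, 0, 1]], ?_, ?_,
      fun x hx => ⟨![B x v', B x u, B x u' + B x v'], ?_⟩⟩,
    splitsAlong_of_mem ![0, 2] ?_ fun x hx => ⟨![B x v', B x v], ?_⟩,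
    splitsAlong_of_mem ![1, 3] ?_ fun x hx => ⟨![B x u', B x u], ?_⟩⟩
  · simp [Fin.forall_fin_succ, zero_mem_coeffs, one_mem_coeffs, *]
  · simp [Fin.forall_fin_succ, Fin.sum_univ_succ, *] at ha
    ext i; fin_cases i <;> simp <;> grind
  · simp [Fin.forall_fin_succ, zero_mem_coeffs, one_mem_coeffs, neg_one_mem_coeffs]
  · simpa [Fin.forall_fin_succ, Fin.sum_univ_succ, ← sub_eq_add_neg] using ⟨by assumption, hw, hp⟩
  · have e := h.apply_eq hx
    rw [hT.symm _ x, hT.symm _ x] at e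
    simp [Fin.forall_fin_succ, Fin.sum_univ_succ, hT.isoW x hx w hw, hT.isoW x hx p hp, *]
  · simpa [Fin.forall_fin_succ] using ⟨h.1, hu'⟩
  · have e := hw₁ x hx
    have e' := hp₁ x hx
    rw [hT.symm, hT.symm _ x] at e e'
    simp [Fin.forall_fin_succ, Fin.sum_univ_succ, hT.iso₁ x hx _ h.1, hT.iso₁ x hx _ hu', *]
  · simpa [Fin.forall_fin_succ] using ⟨h.2.1, hv'⟩
  · have e := hw₂ x hx
    have e' := hp₂ x hx
    rw [hT.symm, hT.symm _ x] at e
    rw [hT.symm, map_zero, LinearMap.zero_apply] at e'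
    simp [Fin.forall_fin_succ, Fin.sum_univ_succ, hT.iso₂ x hx _ h.2.1, hT.iso₂ x hx _ hv', *]

lemma IsIrred.eq_zero_of_left [FiniteDimensional F V]
    (hT : IsTriple c B φ W U₁ U₂) (hN : IsIrred (coeffs c) B W U₁ U₂) {u : V}
    (hu : u ∈ U₁) : u = 0 := by
  by_contra h0
  have hE : ∀ y y', PerpDiff B W U₁ U₂ y y' → y = 0 ∧ y' = 0 := fun y y' h =>
    ⟨hN.eq_zero_of_perpDiff hT h, hN.swap.eq_zero_of_perpDiff hT.swap h.swap⟩
  have hne : ¬ ∀ v ∈ U₂, B u v = 0 := fun hv => by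
    obtain ⟨v, hv, huv⟩ := hN.exists_sub_perp hT hu hv
    exact h0 (hE u v ⟨hu, hv, huv⟩).1
  push Not at hne
  obtain ⟨v, hv, huv⟩ := hne
  obtain ⟨v, hv, h12⟩ : ∃ v ∈ U₂, B u v = 1 := ⟨(B u v)⁻¹ • v, U₂.smul_mem _ hv, by simp [huv]⟩
  have h21 := (hT.symm v u).trans h12
  obtain ⟨w, hw, hw₁, hw₂⟩ := exists_mem_represent hT.symm W U₁ U₂ v 0
    (fun y hy y' hy' hyy => by simp [(hE y y' ⟨hy, hy', hyy⟩).1])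
  obtain ⟨p, hp, hp₁, hp₂⟩ := exists_mem_represent hT.symm W U₁ U₂ 0 u
    (fun y hy y' hy' hyy => by simp [(hE y y' ⟨hy, hy', hyy⟩).2])
  have h11 := hT.iso₁ u hu u hu
  have h22 := hT.iso₂ v hv v hv
  have h31 := (hw₁ u hu).trans h21
  have h32 := hw₂ v hv
  have h41 := hp₁ u hu
  have h42 := (hp₂ v hv).trans h12
  rw [map_zero, LinearMap.zero_apply] at h32 h41
  have h13 := (hT.symm u w).trans h31
  have h23 := (hT.symm v w).trans h32
  have h14 := (hT.symm u p).trans h41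
  have h24 := (hT.symm v p).trans h42
  have h33 := hT.isoW w hw w hw
  have h34 := hT.isoW w hw p hp
  have h43 := hT.isoW p hp w hw
  have h44 := hT.isoW p hp p hp
  refine hN 3 ![u, v, w, p] ⟨?_, fun a ha => ?_,
    splitsAlong_of_mem ![2, 3] ?_ fun x hx => ⟨![B x u, B x v], ?_⟩,
    splitsAlong_of_mem ![0] ?_ fun x hx => ⟨![B x v], ?_⟩,
    splitsAlong_of_mem ![1] ?_ fun x hx => ⟨![B x u], ?_⟩⟩
  · simp [Fin.forall_fin_succ, zero_mem_coeffs, one_mem_coeffs, *]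
  · simp [Fin.forall_fin_succ, Fin.sum_univ_succ, *] at ha
    ext i; fin_cases i <;> simp <;> grind
  · simpa [Fin.forall_fin_succ] using ⟨hw, hp⟩
  · simp [Fin.forall_fin_succ, Fin.sum_univ_succ, hT.isoW x hx w hw, hT.isoW x hx p hp, *]
  · simpa [Fin.forall_fin_succ] using hu
  · have e := hw₁ x hx
    have e' := hp₁ x hx
    rw [hT.symm, hT.symm _ x] at e
    rw [hT.symm, map_zero, LinearMap.zero_apply] at e'
    simp [Fin.forall_fin_succ, hT.iso₁ x hx _ hu, *]
  · simpa [Fin.forall_fin_succ] using hv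
  · have e := hp₂ x hx
    have e' := hw₂ x hx
    rw [hT.symm, hT.symm _ x] at e
    rw [hT.symm, map_zero, LinearMap.zero_apply] at e'
    simp [Fin.forall_fin_succ, hT.iso₂ x hx _ hv, *]

/-- An irreducible triple is zero. -/
lemma IsIrred.subsingleton [FiniteDimensional F V]
    (hT : IsTriple c B φ W U₁ U₂) (hN : IsIrred (coeffs c) B W U₁ U₂) : Subsingleton V := by
  have hc := hT.coeff_ne
  have h₁ : ∀ x ∈ U₁, x = 0 := fun x hx => hN.eq_zero_of_left hT hx
  have h₂ : ∀ x ∈ U₂, x = 0 := fun x hx => hN.swap.eq_zero_of_left hT.swap hx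
  have hW : ∀ x ∈ W, x = 0 := fun x hx => by
    have := hN.mem_sup hT hx (fun y hy => by simp [h₁ y hy]) (fun y hy => by simp [h₂ y hy])
    obtain ⟨y, hy, y', hy', rfl⟩ := Submodule.mem_sup.1 this
    simp [h₁ y hy, h₂ y' hy']
  have hp : ∀ x, ∀ w ∈ W, B x w = 0 := fun x w hw => by simp [hW w hw]
  refine subsingleton_of_forall_eq 0 fun e => ?_
  by_contra h0
  have hφ : φ e ≠ 0 := fun hφ => h0 (hW e (hT.mem_of_perp e (hp e) hφ))
  have hgram : B ((φ e)⁻¹ • e) ((φ e)⁻¹ • e) = c := by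
    rw [hT.perp _ _ (hp _) (hp _)]
    simp [hφ]
  refine hN 0 ![(φ e)⁻¹ • e] ⟨?_, fun a ha => ?_, splitsAlong_of_perp fun x hx => ?_,
    splitsAlong_of_perp fun x hx => ?_, splitsAlong_of_perp fun x hx => ?_⟩
  · intro i j
    fin_cases i; fin_cases j
    exact hgram ▸ self_mem_coeffs c
  · simp only [Fin.forall_fin_succ, Fin.sum_univ_succ, Matrix.cons_val_zero, hgram] at ha
    ext i; fin_cases i; simpa [hc] using ha
  · simp [hW x hx]
  · simp [h₁ x hx]
  · simp [h₂ x hx]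

/-- The orthogonal complement of a family of vectors. -/
def familyPerp (B : LinearMap.BilinForm F V) {k : ℕ} (h : Fin k → V) : Submodule F V where
  carrier := {x | ∀ i, B x (h i) = 0}
  zero_mem' := by simp
  add_mem' ha hb i := by simp [ha i, hb i]
  smul_mem' t a ha i := by simp [ha i]

lemma SplitsAlong.exists_decomp {S : Set F} {k : ℕ} {h : Fin k → V} {U : Submodule F V}
    (hU : SplitsAlong S B h U) : ∃ s : Set (Fin k → F), (∀ a ∈ s, ∀ i, a i ∈ S) ∧
      (∀ a ∈ s, ∑ i, a i • h i ∈ U) ∧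
      ∀ x ∈ U, ∃ y ∈ Submodule.span F ((fun a => ∑ i, a i • h i) '' s),
        x - y ∈ familyPerp B h := by
  obtain ⟨m, A, hA, hAU, hx⟩ := hU
  refine ⟨Set.range A, ?_, ?_, fun x hxU => ?_⟩
  · rintro _ ⟨j, rfl⟩; exact hA j
  · rintro _ ⟨j, rfl⟩; exact hAU j
  · obtain ⟨t, ht⟩ := hx x hxU
    refine ⟨∑ j, t j • ∑ i, A j i • h i, Submodule.sum_mem _ fun j _ => Submodule.smul_mem _ _
      (Submodule.subset_span ⟨A j, ⟨j, rfl⟩, rfl⟩), fun i => ?_⟩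
    simp [ht i]

lemma IsBlock.exists_sub_mem {S : Set F} {k : ℕ} {h : Fin k → V}
    (hb : IsBlock S B W U₁ U₂ h) (x : V) :
    ∃ a : Fin k → F, x - ∑ i, a i • h i ∈ familyPerp B h := by
  let G : (Fin k → F) →ₗ[F] (Fin k → F) :=
    LinearMap.pi fun j => ∑ i, B (h i) (h j) • LinearMap.proj i
  have hG : Function.Injective G := by
    rw [injective_iff_map_eq_zero]
    intro a ha
    refine hb.nondeg a fun j => ?_
    simpa [G, mul_comm] using congrFun ha j
  obtain ⟨a, ha⟩ := (LinearMap.injective_iff_surjective.1 hG) fun j => B x (h j)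
  refine ⟨a, fun j => ?_⟩
  have := congrFun ha j
  simp only [G, LinearMap.pi_apply, LinearMap.sum_apply, LinearMap.smul_apply,
    LinearMap.proj_apply, smul_eq_mul] at this
  simp [← this, mul_comm]

lemma SplitsAlong.perp_of_comap {S : Set F} {k : ℕ} {h : Fin k → V} {U : Submodule F V}
    (hU : SplitsAlong S B h U) {x : V} (hx : x ∈ familyPerp B h)
    (hxU : ∀ w : familyPerp B h, (w : V) ∈ U → B x w = 0) : ∀ w ∈ U, B x w = 0 := by
  obtain ⟨s, -, hsU, hs⟩ := hU.exists_decomp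
  intro w hw
  obtain ⟨y, hy, hwy⟩ := hs w hw
  have hyU : y ∈ U := by
    refine Submodule.span_le.2 ?_ hy
    rintro _ ⟨a, ha, rfl⟩
    exact hsU a ha
  have hxy : B x y = 0 := by
    have : Submodule.span F ((fun a => ∑ i, a i • h i) '' s) ≤ LinearMap.ker (B x) := by
      refine Submodule.span_le.2 ?_
      rintro _ ⟨a, ha, rfl⟩
      simp [hx _]
    exact this hy
  have := hxU ⟨w - y, hwy⟩ (U.sub_mem hw hyU)
  simpa [hxy] using this

lemma IsTriple.restrict (hT : IsTriple c B φ W U₁ U₂) {S : Set F} {k : ℕ} {h : Fin k → V}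
    (hb : IsBlock S B W U₁ U₂ h) :
    IsTriple c (B.restrict (familyPerp B h)) (φ.comp (familyPerp B h).subtype)
      (W.comap (familyPerp B h).subtype) (U₁.comap (familyPerp B h).subtype)
      (U₂.comap (familyPerp B h).subtype) where
  two_ne := hT.two_ne
  coeff_ne := hT.coeff_ne
  symm x y := hT.symm x y
  nondeg x hx := by
    refine Subtype.ext (hT.nondeg x fun y => ?_)
    obtain ⟨a, ha⟩ := hb.exists_sub_mem y
    have := hx ⟨_, ha⟩
    simpa [x.2 _] using this
  isoW x hx y hy := hT.isoW x hx y hy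
  iso₁ x hx y hy := hT.iso₁ x hx y hy
  iso₂ x hx y hy := hT.iso₂ x hx y hy
  perp x y hx hy := hT.perp x y (hb.splitsW.perp_of_comap x.2 hx) (hb.splitsW.perp_of_comap y.2 hy)
  mem_of_perp x hx hφ := hT.mem_of_perp x (hb.splitsW.perp_of_comap x.2 hx) hφ

lemma HasNormalForm.of_isBlock (hT : IsTriple c B φ W U₁ U₂) {k : ℕ} {h : Fin k → V}
    (hb : IsBlock (coeffs c) B W U₁ U₂ h)
    (hf : HasNormalForm (coeffs c) (B.restrict (familyPerp B h))
      (W.comap (familyPerp B h).subtype) (U₁.comap (familyPerp B h).subtype)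
      (U₂.comap (familyPerp B h).subtype)) :
    HasNormalForm (coeffs c) B W U₁ U₂ := by
  obtain ⟨ι, _, b, hgram, hsub⟩ := hf
  have hli : LinearIndependent F (Sum.elim h fun j => (b j : V)) := by
    rw [Fintype.linearIndependent_iff]
    intro g hg
    simp only [Fintype.sum_sum_type, Sum.elim_inl, Sum.elim_inr] at hg
    have h0 : (fun i => g (Sum.inl i)) = 0 := hb.nondeg _ fun j => by
      have := congrArg (fun v => B v (h j)) hg
      simpa [(b _).2 j] using this
    have h1 : ∀ j, g (Sum.inr j) = 0 := by
      refine Fintype.linearIndependent_iff.1 b.linearIndependent (fun j => g (Sum.inr j))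
        (Subtype.ext ?_)
      simpa [funext_iff.1 h0 _] using hg
    rintro (i | j)
    exacts [congrFun h0 i, h1 j]
  have hspan : ⊤ ≤ Submodule.span F (Set.range (Sum.elim h fun j => (b j : V))) := by
    intro x _
    obtain ⟨a, ha⟩ := hb.exists_sub_mem x
    rw [← sub_add_cancel x (∑ i, a i • h i)]
    refine Submodule.add_mem _ ?_ (Submodule.sum_mem _ fun i _ => Submodule.smul_mem _ _
      (Submodule.subset_span ⟨Sum.inl i, rfl⟩))
    have : ((∑ i, b.repr ⟨_, ha⟩ i • b i : familyPerp B h) : V) = x - ∑ i, a i • h i :=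
      congrArg Subtype.val (b.sum_repr ⟨_, ha⟩)
    rw [← this, Submodule.coe_sum]
    exact Submodule.sum_mem _ fun j _ => Submodule.smul_mem _ _
      (Submodule.subset_span ⟨Sum.inr j, rfl⟩)
  refine ⟨Fin k ⊕ ι, inferInstance, Basis.mk hli hspan, ?_, fun U hU => ?_⟩
  · rintro (i | i) (j | j)
    · simpa using hb.gram i j
    · simpa [hT.symm (h i), (b j).2 i] using zero_mem_coeffs c
    · simpa [(b i).2 j] using zero_mem_coeffs c
    · simpa using hgram i j
  obtain ⟨hUs, s', hs', hsU'⟩ : SplitsAlong (coeffs c) B h U ∧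
      ∃ s : Set (ι → F), (∀ a ∈ s, ∀ i, a i ∈ coeffs c) ∧ U.comap (familyPerp B h).subtype =
        Submodule.span F ((fun a => ∑ i, a i • b i) '' s) := by
    simp only [List.mem_cons, List.not_mem_nil, or_false] at hU
    rcases hU with rfl | rfl | rfl
    exacts [⟨hb.splitsW, hsub _ (by simp)⟩, ⟨hb.splits₁, hsub _ (by simp)⟩,
      ⟨hb.splits₂, hsub _ (by simp)⟩]
  obtain ⟨s, hs, hsU, hdec⟩ := hUs.exists_decomp
  refine ⟨(fun a => Sum.elim a 0) '' s ∪ (fun a => Sum.elim 0 a) '' s', ?_, ?_⟩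
  · rintro _ (⟨a, ha, rfl⟩ | ⟨a, ha, rfl⟩) (i | i)
    exacts [hs a ha i, zero_mem_coeffs c, zero_mem_coeffs c, hs' a ha i]
  · have e : (fun a : Fin k ⊕ ι → F => ∑ i, a i • Basis.mk hli hspan i) ''
        ((fun a => Sum.elim a 0) '' s ∪ (fun a => Sum.elim 0 a) '' s') =
        (fun a => ∑ i, a i • h i) '' s ∪
          (familyPerp B h).subtype '' ((fun a => ∑ i, a i • b i) '' s') := by
      rw [Set.image_union, Set.image_image, Set.image_image, Set.image_image]
      simp
    rw [e, Submodule.span_union, Submodule.span_image, ← hsU']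
    have hle : Submodule.span F ((fun a => ∑ i, a i • h i) '' s) ≤ U := by
      refine Submodule.span_le.2 ?_
      rintro _ ⟨a, ha, rfl⟩
      exact hsU a ha
    refine le_antisymm (fun x hx => ?_) (sup_le hle (Submodule.map_comap_le _ _))
    obtain ⟨y, hy, hxy⟩ := hdec x hx
    rw [← add_sub_cancel y x]
    exact Submodule.add_mem_sup hy ⟨⟨_, hxy⟩, U.sub_mem hx (hle hy), rfl⟩

lemma IsBlock.finrank_familyPerp_lt [FiniteDimensional F V] {S : Set F} {k : ℕ}
    {h : Fin (k + 1) → V} (hb : IsBlock S B W U₁ U₂ h) :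
    finrank F (familyPerp B h) < finrank F V := by
  refine Submodule.finrank_lt fun htop => ?_
  have h0 : h 0 ∈ familyPerp B h := htop ▸ Submodule.mem_top
  have := hb.nondeg (Pi.single 0 1) fun j => by simpa [Pi.single_apply] using h0 j
  simpa using congrFun this 0

theorem hasNormalForm {F : Type*} [Field F] {c : F} (n : ℕ) :
    ∀ {V : Type*} [AddCommGroup V] [Module F V] [FiniteDimensional F V]
      {B : LinearMap.BilinForm F V} {φ : V →ₗ[F] F} {W U₁ U₂ : Submodule F V},
      finrank F V = n → IsTriple c B φ W U₁ U₂ → HasNormalForm (coeffs c) B W U₁ U₂ := by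
  induction n using Nat.strong_induction_on with
  | _ n ih =>
    intro V _ _ _ B φ W U₁ U₂ hn hT
    by_cases hN : IsIrred (coeffs c) B W U₁ U₂
    · have := hN.subsingleton hT
      refine ⟨Fin 0, inferInstance, Basis.empty V, fun i => i.elim0, fun U _ => ⟨∅, by simp, ?_⟩⟩
      exact Subsingleton.elim _ _
    · simp only [IsIrred, not_forall, not_not] at hN
      obtain ⟨k, h, hb⟩ := hN
      exact .of_isBlock hT hb (ih _ (hn ▸ hb.finrank_familyPerp_lt) rfl (hT.restrict hb))

end triple

section splitForm

/-- `bform` as a bilinear form. -/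
def splitForm (F : Type*) [Field F] (N : ℕ) : LinearMap.BilinForm F (Fin N → F) :=
  LinearMap.mk₂ F (bform F N)
    (fun u v w => by simp [bform, add_mul, Finset.sum_add_distrib])
    (fun a u v => by simp [bform, mul_assoc, Finset.mul_sum])
    (fun u v w => by simp [bform, mul_add, Finset.sum_add_distrib])
    (fun a u v => by simp [bform, mul_left_comm, Finset.mul_sum])

variable {F : Type*} [Field F] {N : ℕ}

lemma splitForm_apply (u v : Fin N → F) : splitForm F N u v = bform F N u v := rfl

lemma splitForm_symm (u v : Fin N → F) : splitForm F N u v = splitForm F N v u := by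
  simp only [splitForm_apply, bform]
  rw [← Equiv.sum_comp Fin.revPerm]
  simp [mul_comm]

lemma splitForm_nondeg (u : Fin N → F) (hu : ∀ v, splitForm F N u v = 0) : u = 0 := by
  funext i
  have := hu (Pi.single i.rev 1)
  simpa [splitForm_apply, bform, Pi.single_apply, Fin.rev_inj] using this

lemma splitForm_nondegenerate : (splitForm F N).Nondegenerate := by
  refine ⟨fun u hu => splitForm_nondeg u hu, fun u hu => splitForm_nondeg u fun v => ?_⟩
  rw [splitForm_symm]
  exact hu v

lemma splitForm_isRefl : (splitForm F N).IsRefl := fun u v h => by rwa [splitForm_symm]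

lemma exists_splitForm_eq (f : (Fin N → F) →ₗ[F] F) : ∃ u, splitForm F N u = f := by
  have hinj : Function.Injective (splitForm F N) := by
    rw [injective_iff_map_eq_zero]
    exact fun y hy => splitForm_nondeg y fun z => by rw [hy]; rfl
  exact (LinearMap.injective_iff_surjective_of_finrank_eq_finrank
    (Subspace.dual_finrank_eq (K := F) (V := Fin N → F)).symm).1 hinj f

/-- The discriminant of the split form is `±1`. -/
lemma exists_det_gram_eq {ι : Type*} [Fintype ι] [DecidableEq ι] (ε : ι ≃ Fin N)
    (v : ι → Fin N → F) : ∃ t δ : F, δ * δ = 1 ∧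
      (Matrix.of fun i j => splitForm F N (v i) (v j)).det = δ * t ^ 2 := by
  let J : Matrix (Fin N) (Fin N) F := Matrix.of fun i j => if j = i.rev then 1 else 0
  let P : Matrix (Fin N) (Fin N) F := Matrix.of fun i j => v (ε.symm i) j
  have hJ : J * J = 1 := by
    ext i j
    rw [Matrix.mul_apply, Finset.sum_eq_single i.rev (by simp +contextual [J]) (by simp)]
    simp [J, Matrix.one_apply, eq_comm]
  have hP : (Matrix.of fun i j => splitForm F N (v i) (v j)).submatrix ε.symm ε.symm =
      P * J * P.transpose := by
    ext i j
    rw [Matrix.mul_assoc]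
    simp [J, P, Matrix.mul_apply, splitForm_apply, bform]
  refine ⟨P.det, J.det, by rw [← Matrix.det_mul, hJ, Matrix.det_one], ?_⟩
  rw [← Matrix.det_submatrix_equiv_self ε.symm, hP, Matrix.det_mul, Matrix.det_mul,
    Matrix.det_transpose]
  ring

lemma det_fromBlocks_zero_one_one {ι : Type*} [Fintype ι] [DecidableEq ι] (s : Matrix ι ι F) :
    (Matrix.fromBlocks (0 : Matrix ι ι F) 1 1 s).det *
      (Matrix.fromBlocks (0 : Matrix ι ι F) 1 1 s).det = 1 := by
  have h : Matrix.fromBlocks (0 : Matrix ι ι F) 1 1 s =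
      Matrix.fromBlocks (0 : Matrix ι ι F) 1 1 0 *
        Matrix.fromBlocks (1 : Matrix ι ι F) s 0 1 := by
    simp [Matrix.fromBlocks_multiply]
  have h2 : Matrix.fromBlocks (0 : Matrix ι ι F) (1 : Matrix ι ι F) (1 : Matrix ι ι F) 0 *
      Matrix.fromBlocks (0 : Matrix ι ι F) (1 : Matrix ι ι F) (1 : Matrix ι ι F) 0 = 1 := by
    simp [Matrix.fromBlocks_multiply]
  rw [h, Matrix.det_mul, Matrix.det_fromBlocks_zero₂₁, Matrix.det_one, mul_one, mul_one,
    ← Matrix.det_mul, h2, Matrix.det_one]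

/-- An anisotropic vector orthogonal to a maximal isotropic subspace has square norm up to
sign. -/
lemma exists_apply_self_eq {n : ℕ} {W : Submodule F (Fin (2 * n + 1) → F)}
    (hW : finrank F W = n) (hiso : ∀ x ∈ W, ∀ y ∈ W, splitForm F _ x y = 0)
    {e : Fin (2 * n + 1) → F} (he : ∀ w ∈ W, splitForm F _ e w = 0)
    (hq : splitForm F _ e e ≠ 0) :
    ∃ t δ : F, δ * δ = 1 ∧ splitForm F _ e e = δ * t ^ 2 := by
  set B := splitForm F (2 * n + 1) with hB
  set q := B e e
  let w : Basis (Fin n) F W := finBasisOfFinrankEq F W hW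
  have hdual : ∀ i, ∃ f, B f e = 0 ∧ ∀ j, B f (w j) = if i = j then 1 else 0 := fun i => by
    obtain ⟨g, hg⟩ := (w.coord i).exists_extend
    obtain ⟨f, rfl⟩ := exists_splitForm_eq g
    have hf : ∀ j, B f (w j) = if i = j then 1 else 0 := fun j => by
      have := LinearMap.congr_fun hg (w j)
      simpa [Finsupp.single_apply, eq_comm] using this
    refine ⟨f - (B f e / q) • e, by simp [q, hq], fun j => ?_⟩
    simp [he _ (w j).2, hf]
  choose f hfe hfw using hdual
  let v : (Fin n ⊕ Fin n) ⊕ Unit → Fin (2 * n + 1) → F :=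
    Sum.elim (Sum.elim (fun i => (w i : Fin (2 * n + 1) → F)) f) fun _ => e
  have ε : (Fin n ⊕ Fin n) ⊕ Unit ≃ Fin (2 * n + 1) :=
    Fintype.equivFinOfCardEq (by simp [two_mul])
  obtain ⟨t, δ, hδ, hdet⟩ := exists_det_gram_eq ε v
  have hs := fun x y => splitForm_symm (F := F) (N := 2 * n + 1) x y
  have hM : (Matrix.of fun i j => splitForm F (2 * n + 1) (v i) (v j)) = Matrix.fromBlocks
      (Matrix.fromBlocks 0 1 1 (Matrix.of fun i j => B (f i) (f j))) 0 0
      (Matrix.of fun _ _ : Unit => q) := by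
    ext ((i | i) | i) ((j | j) | j)
    · exact hiso _ (w i).2 _ (w j).2
    · exact (hs _ _).trans ((hfw _ _).trans (by simp [Matrix.one_apply, eq_comm]))
    · exact (hs _ _).trans (he _ (w i).2)
    · exact (hfw _ _).trans (by simp [Matrix.one_apply])
    · rfl
    · exact hfe _
    · exact he _ (w j).2
    · exact (hs _ _).trans (hfe _)
    · rfl
  rw [hM, Matrix.det_fromBlocks_zero₂₁, Matrix.det_unique (n := Unit)] at hdet
  have hd := det_fromBlocks_zero_one_one (Matrix.of fun i j => B (f i) (f j))
  set d := (Matrix.fromBlocks (0 : Matrix (Fin n) (Fin n) F) 1 1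
    (Matrix.of fun i j => B (f i) (f j))).det
  refine ⟨t, d * δ, by linear_combination δ * δ * hd + hδ, ?_⟩
  simp only [Matrix.of_apply] at hdet
  linear_combination d * hdet - q * hd

lemma exists_isTriple (hchar : (2 : F) ≠ 0) {n : ℕ}
    {W U₁ U₂ : Submodule F (Fin (2 * n + 1) → F)} (hW : finrank F W = n)
    (isoW : ∀ x ∈ W, ∀ y ∈ W, splitForm F _ x y = 0)
    (iso₁ : ∀ x ∈ U₁, ∀ y ∈ U₁, splitForm F _ x y = 0)
    (iso₂ : ∀ x ∈ U₂, ∀ y ∈ U₂, splitForm F _ x y = 0) :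
    ∃ c φ, (c = 1 ∨ c = -1) ∧ IsTriple c (splitForm F (2 * n + 1)) φ W U₁ U₂ := by
  set B := splitForm F (2 * n + 1) with hB
  have hs : ∀ x y, B x y = B y x := splitForm_symm
  have hmem : ∀ x, x ∈ B.orthogonal W ↔ ∀ w ∈ W, B x w = 0 := fun x => by
    simp only [LinearMap.BilinForm.mem_orthogonal_iff, hs x]
  have hrank : finrank F (B.orthogonal W) = n + 1 := by
    rw [LinearMap.BilinForm.finrank_orthogonal splitForm_nondegenerate, hW,
      finrank_fin_fun]
    omega
  have hle : W ≤ B.orthogonal W := fun x hx => (hmem x).2 (isoW x hx)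
  obtain ⟨e, he, heW⟩ : ∃ e ∈ B.orthogonal W, e ∉ W := by
    by_contra! h
    have : W = B.orthogonal W := le_antisymm hle h
    rw [← this] at hrank
    omega
  have htop : B.orthogonal W = W ⊔ Submodule.span F {e} := by
    refine (Submodule.eq_of_le_of_finrank_le
      (sup_le hle ((Submodule.span_singleton_le_iff_mem _ _).2 he)) ?_).symm
    have : W < W ⊔ Submodule.span F {e} := by
      refine lt_of_le_of_ne le_sup_left fun h => heW ?_
      rw [h]
      exact Submodule.mem_sup_right (Submodule.mem_span_singleton_self e)
    have := Submodule.finrank_lt_finrank_of_lt this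
    omega
  have hdec : ∀ x, (∀ w ∈ W, B x w = 0) → ∃ w ∈ W, ∃ t : F, x = w + t • e := fun x hx => by
    have hx := (hmem x).2 hx
    rw [htop, Submodule.mem_sup] at hx
    obtain ⟨w, hw, y, hy, rfl⟩ := hx
    obtain ⟨t, rfl⟩ := Submodule.mem_span_singleton.1 hy
    exact ⟨w, hw, t, rfl⟩
  have he := (hmem e).1 he
  have hq : B e e ≠ 0 := fun h => heW <| by
    rw [← LinearMap.BilinForm.orthogonal_orthogonal splitForm_nondegenerate splitForm_isRefl W]
    refine (LinearMap.BilinForm.mem_orthogonal_iff).2 fun x hx => ?_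
    obtain ⟨w, hw, t, rfl⟩ := hdec x ((hmem x).1 hx)
    rw [← hB]
    simp [h, hs w, he w hw]
  obtain ⟨t, δ, hδ, hqt⟩ := exists_apply_self_eq hW isoW he hq
  rw [← hB] at hqt
  have ht : t ≠ 0 := by rintro rfl; simp [hqt] at hq
  have hδ0 : δ ≠ 0 := by rintro rfl; simp at hδ
  have hφ : ∀ w ∈ W, ∀ a : F, B e (w + a • e) = a * (δ * t ^ 2) := fun w hw a => by
    simp [he w hw, hqt]
  refine ⟨δ, (δ * t)⁻¹ • B e, mul_self_eq_one_iff.1 hδ, hchar, hδ0, hs, splitForm_nondeg,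
    isoW, iso₁, iso₂, fun x y hx hy => ?_, fun x hx hφx => ?_⟩
  · obtain ⟨w, hw, a, rfl⟩ := hdec x hx
    obtain ⟨w', hw', a', rfl⟩ := hdec y hy
    have : B (w + a • e) (w' + a' • e) = a * (a' * (δ * t ^ 2)) := by
      simp only [map_add, map_smul, LinearMap.add_apply, LinearMap.smul_apply, smul_eq_mul,
        isoW w hw w' hw', hs w e, he w hw, he w' hw', hqt]
      ring
    rw [this, LinearMap.smul_apply, LinearMap.smul_apply, hφ w hw, hφ w' hw']
    simp only [smul_eq_mul]
    field_simp
  · obtain ⟨w, hw, a, rfl⟩ := hdec x hx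
    rw [LinearMap.smul_apply, hφ w hw] at hφx
    have : a = 0 := by simpa [hδ0, ht] using hφx
    simpa [this] using hw

end splitForm

section code

variable {F : Type*} [Field F] {V : Type*} [AddCommGroup V] [Module F V]

/-- The family `U` of subspaces is described, in some basis of `V`, by the Gram matrix `p.1` and
the spanning sets `p.2`, all with entries in `S`. -/
def HasCode {S : Set F} {κ : Type*} {N : ℕ} (B : LinearMap.BilinForm F V) (U : κ → Submodule F V)
    (p : (Fin N → Fin N → S) × (κ → Set (Fin N → S))) : Prop :=
  ∃ b : Basis (Fin N) F V, (∀ i j, B (b i) (b j) = p.1 i j) ∧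
    ∀ k, U k = Submodule.span F ((fun a : Fin N → S => ∑ i, (a i : F) • b i) '' p.2 k)

lemma HasNormalForm.exists_hasCode {S T : Set F} (hST : S ⊆ T) {B : LinearMap.BilinForm F V}
    {W U₁ U₂ : Submodule F V} (h : HasNormalForm S B W U₁ U₂) {N : ℕ} (hN : finrank F V = N) :
    ∃ p : (Fin N → Fin N → T) × (Fin 3 → Set (Fin N → T)), HasCode B ![W, U₁, U₂] p := by
  obtain ⟨ι, _, b, hgram, hsub⟩ := h
  let e : ι ≃ Fin N := Fintype.equivFinOfCardEq (by rw [← hN, finrank_eq_card_basis b])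
  have hU : ∀ k, ∃ s : Set (Fin N → T), ![W, U₁, U₂] k =
      Submodule.span F ((fun a : Fin N → T => ∑ i, (a i : F) • b.reindex e i) '' s) := fun k => by
    obtain ⟨s, hs, hk⟩ := hsub (![W, U₁, U₂] k) (by fin_cases k <;> simp)
    refine ⟨{a | (fun i => (a (e i) : F)) ∈ s}, ?_⟩
    rw [hk]
    congr 1
    ext x
    constructor
    · rintro ⟨a, ha, rfl⟩
      refine ⟨fun j => ⟨a (e.symm j), hST (hs a ha _)⟩, by simpa using ha, ?_⟩
      simp [← e.sum_comp]
    · rintro ⟨a, ha, rfl⟩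
      exact ⟨_, ha, by simp [← e.sum_comp]⟩
  choose s hs using hU
  exact ⟨(fun i j => ⟨_, hST (hgram (e.symm i) (e.symm j))⟩, s), b.reindex e, by simp, hs⟩

/-- Families with the same code are conjugate under an isometry. -/
lemma HasCode.exists_isometry {S : Set F} {κ : Type*} {N : ℕ} {B : LinearMap.BilinForm F V}
    {U U' : κ → Submodule F V} {p : (Fin N → Fin N → S) × (κ → Set (Fin N → S))}
    (h : HasCode B U p) (h' : HasCode B U' p) :
    ∃ g : V ≃ₗ[F] V, (∀ x y, B (g x) (g y) = B x y) ∧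
      ∀ k, (U k).map g.toLinearMap = U' k := by
  obtain ⟨b, hb, hU⟩ := h
  obtain ⟨b', hb', hU'⟩ := h'
  refine ⟨b.equiv b' (Equiv.refl _), fun x y => ?_, fun k => ?_⟩
  · have : B.comp (b.equiv b' (Equiv.refl _)).toLinearMap (b.equiv b' (Equiv.refl _)).toLinearMap
        = B := LinearMap.BilinForm.ext_basis b fun i j => by simp [hb, hb']
    exact LinearMap.congr_fun₂ this x y
  · rw [hU, hU', Submodule.map_span, Set.image_image]
    simp

end code

lemma finite_quot_of_code {X P : Type*} [Finite P] {r : X → X → Prop} {R : X → P → Prop}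
    (hR : ∀ x, ∃ p, R x p) (hr : ∀ x y p, R x p → R y p → r x y) : Finite (Quot r) := by
  choose f hf using hR
  refine Finite.of_injective (fun q : Quot r => f q.out) fun q q' h => ?_
  rw [← q.out_eq, ← q'.out_eq]
  exact Quot.sound (hr _ _ _ (hf _) (by
    have := hf q'.out
    rwa [← show f q.out = f q'.out from h] at this))

lemma coeffs_finite {F : Type*} [Field F] (c : F) : (coeffs c).Finite := by
  simp [coeffs]

end OrthTriple

/-- for any `1 ≤ α, β ≤ n`, the triple flag variety
`M_{(α)} × M_{(β)} × M_{(n)}` has finitely many `O_{2n+1}(F)`-orbits. -/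
theorem statement16 (F : Type*) [Field F] (hchar : (2 : F) ≠ 0)
    (n : ℕ) (hn : 1 ≤ n) (α β : ℕ)
    (hα1 : 1 ≤ α) (hαn : α ≤ n) (hβ1 : 1 ≤ β) (hβn : β ≤ n) :
    Finite (Quot (TripleRel F n 1 1 1 ![α] ![β] ![n])) := by
  let T : Set F := OrthTriple.coeffs 1 ∪ OrthTriple.coeffs (-1)
  have : Finite T := ((OrthTriple.coeffs_finite 1).union (OrthTriple.coeffs_finite (-1))).to_subtype
  refine OrthTriple.finite_quot_of_code (P := (Fin (2 * n + 1) → Fin (2 * n + 1) → T) ×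
    (Fin 3 → Set (Fin (2 * n + 1) → T)))
    (R := fun x p => OrthTriple.HasCode (OrthTriple.splitForm F (2 * n + 1))
      ![x.2.2.1 0, x.1.1 0, x.2.1.1 0] p)
    (fun x => ?_) fun x y p hx hy => ?_
  · obtain ⟨⟨U₁, h₁⟩, ⟨U₂, h₂⟩, ⟨W, hW⟩⟩ := x
    obtain ⟨c, φ, hc, hT⟩ := OrthTriple.exists_isTriple hchar ((hW.2.1 0).trans (by
      rw [show Finset.Iic (0 : Fin 1) = {0} from rfl]; simp)) (hW.2.2 0)
      (h₁.2.2 0) (h₂.2.2 0)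
    refine (OrthTriple.hasNormalForm _ rfl hT).exists_hasCode ?_ (finrank_fin_fun F)
    rcases hc with rfl | rfl
    exacts [Set.subset_union_left, Set.subset_union_right]
  · obtain ⟨g, hg, hU⟩ := hx.exists_isometry hy
    refine ⟨g, hg, fun i => ?_, fun i => ?_, fun i => ?_⟩ <;> rw [Subsingleton.elim i 0]
    exacts [hU 1, hU 2, hU 0]
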